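/- In the setting of the uniform deviation bound: let E, c, L, B, s, f, q*, z_1,…,z_n, A'', ℓ̂, ℓ, L̃, M, η be as there, and suppose additionally that there exists α* ∈ A'' with q* = f(Eᵀα*). Let α̂ be any minimizer of ℓ̂ over A''. Then for all t > 0, P( D(q*‖f(Eᵀα̂)) ≥ 2t + 4·L̃·η ) ≤ 2·M·exp(−2·n·t²/(log c)²). -/

import Mathlib

open MeasureTheory ProbabilityTheory

/-- KL divergence between probability vectors on `Fin T` (finite value; the sum runs
over the support of the first argument). -/
noncomputable def KLdiv {T : ℕ} (p q : Fin T → ℝ) : ℝ :=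
  ∑ k ∈ Finset.univ.filter fun k => 0 < p k, p k * Real.log (p k / q k)

/-- The set of `s`-sparse vectors in `ℝ^T` of Euclidean norm at most `B`. -/
def sparseBall (T s : ℕ) (B : ℝ) : Set (Fin T → ℝ) :=
  {α | (Finset.univ.filter fun k => α k ≠ 0).card ≤ s ∧ Real.sqrt (∑ k, (α k) ^ 2) ≤ B}

lemma aux_hoeff {Ω : Type*} [MeasurableSpace Ω] (μ : Measure Ω) [IsProbabilityMeasure μ]
    {T n : ℕ} (hn : 0 < n) (q : Fin T → ℝ) (hq0 : ∀ k, 0 ≤ q k)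
    (z : Fin n → Ω → Fin T) (hmeas : ∀ i, Measurable (z i))
    (hindep : iIndepFun z μ)
    (hlaw : ∀ (i : Fin n) (k : Fin T), μ {ω | z i ω = k} = ENNReal.ofReal (q k))
    (g : Fin T → ℝ) (a b : ℝ) (hab : a < b) (hg : ∀ k, g k ∈ Set.Icc a b) (t : ℝ) (ht : 0 < t) :
    μ.real {ω | n * t ≤ ∑ i, (g (z i ω) - ∑ k, q k * g k)}
      ≤ Real.exp (-(2 * n * t ^ 2) / (b - a) ^ 2) := by
  have hgm : Measurable g := measurable_of_finite g
  have hint : ∀ i, ∫ ω, g (z i ω) ∂μ = ∑ k, q k * g k := by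
    intro i
    have h1 : ∫ ω, g (z i ω) ∂μ = ∫ k, g k ∂(μ.map (z i)) :=
      (integral_map (hmeas i).aemeasurable hgm.aestronglyMeasurable).symm
    have : IsProbabilityMeasure (μ.map (z i)) :=
      Measure.isProbabilityMeasure_map (hmeas i).aemeasurable
    rw [h1, integral_fintype Integrable.of_finite]
    refine Finset.sum_congr rfl fun k _ => ?_
    rw [smul_eq_mul, Measure.real, Measure.map_apply (hmeas i) (measurableSet_singleton k)]
    have : z i ⁻¹' {k} = {ω | z i ω = k} := rfl
    rw [this, hlaw, ENNReal.toReal_ofReal (hq0 k)]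
  have hsub : ∀ i ∈ (Finset.univ : Finset (Fin n)),
      HasSubgaussianMGF (fun ω => g (z i ω) - ∑ k, q k * g k) ((‖b - a‖₊ / 2) ^ 2) μ := by
    intro i _
    have := hasSubgaussianMGF_of_mem_Icc (μ := μ) (X := fun ω => g (z i ω)) (a := a) (b := b)
      (hgm.comp (hmeas i)).aemeasurable (Filter.Eventually.of_forall fun ω => hg _)
    rw [hint i] at this
    exact this
  have hind : iIndepFun (fun i ω => g (z i ω) - ∑ k, q k * g k) μ :=
    hindep.comp (fun _ x => g x - ∑ k, q k * g k) (fun _ => measurable_of_finite _)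
  have hnR : (0 : ℝ) < n := by exact_mod_cast hn
  have h := HasSubgaussianMGF.measure_sum_ge_le_of_iIndepFun hind hsub
    (ε := n * t) (by positivity)
  refine h.trans (le_of_eq ?_)
  congr 1
  have hba : (0 : ℝ) < b - a := by linarith
  simp only [Finset.sum_const, Finset.card_univ, Fintype.card_fin, nsmul_eq_mul]
  push_cast
  rw [Real.norm_of_nonneg hba.le]
  field_simp

lemma aux_log {c x y : ℝ} (hc : 0 < c) (hx : c ≤ x) (hy : c ≤ y) :
    Real.log x - Real.log y ≤ |x - y| / c := by
  have hx0 : 0 < x := by linarith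
  have hy0 : 0 < y := by linarith
  rw [← Real.log_div hx0.ne' hy0.ne']
  have h1 := Real.log_le_sub_one_of_pos (div_pos hx0 hy0)
  have h2 : x / y - 1 = (x - y) / y := by field_simp
  rw [h2] at h1
  calc _ ≤ (x - y) / y := h1
    _ ≤ |x - y| / y := by gcongr; exact le_abs_self _
    _ ≤ |x - y| / c := by gcongr

lemma aux_tri {T : ℕ} (x y w : Fin T → ℝ) {η : ℝ}
    (h1 : Real.sqrt (∑ k, (x k - w k) ^ 2) ≤ η) (h2 : Real.sqrt (∑ k, (y k - w k) ^ 2) ≤ η) :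
    Real.sqrt (∑ k, (x k - y k) ^ 2) ≤ 2 * η := by
  have key : ∀ u v : Fin T → ℝ, Real.sqrt (∑ k, (u k - v k) ^ 2)
      = dist (WithLp.toLp 2 u : EuclideanSpace ℝ (Fin T)) (WithLp.toLp 2 v) := by
    intro u v
    rw [EuclideanSpace.dist_eq]
    simp [Real.dist_eq, sq_abs]
  rw [key] at *
  have := dist_triangle_right (WithLp.toLp 2 x : EuclideanSpace ℝ (Fin T))
    (WithLp.toLp 2 y) (WithLp.toLp 2 w)
  linarith

/-- Per-token excess-risk bound (from the proof of Theorem 3.2): in the setting of the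
uniform deviation bound, if moreover `q* = f(Eᵀα*)` for some feasible `α*` and `α̂` is
any minimizer of the empirical loss `ℓ̂` over the feasible set `A''`, then
`P(D(q*‖f(Eᵀα̂)) ≥ 2t + 4 L̃ η) ≤ 2 M exp(−2 n t² / (log c)²)`. -/
theorem stmt_11
    {Ω : Type*} [MeasurableSpace Ω] (μ : Measure Ω) [IsProbabilityMeasure μ]
    {T d n : ℕ} (E : Matrix (Fin T) (Fin d) ℝ) (σ : ℝ)
    (hσ : ∀ α : Fin T → ℝ,
      Real.sqrt (∑ j, (E.transpose.mulVec α j) ^ 2) ≤ σ * Real.sqrt (∑ k, (α k) ^ 2))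
    (c : ℝ) (hc0 : 0 < c) (hc1 : c < 1) (L : ℝ) (hL : 0 < L)
    (B : ℝ) (hB : 0 < B) (s : ℕ) (hs1 : 1 ≤ s) (hsT : s ≤ T)
    (f : (Fin d → ℝ) → Fin T → ℝ)
    (hLip : ∀ x y : Fin d → ℝ, ∑ k, |f x k - f y k| ≤ L * Real.sqrt (∑ j, (x j - y j) ^ 2))
    (hrange : ∀ x k, f x k = 0 ∨ (c ≤ f x k ∧ f x k ≤ 1))
    (hfprob : ∀ α : Fin T → ℝ, ∑ k, f (E.transpose.mulVec α) k = 1)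
    (qstar : Fin T → ℝ) (hq0 : ∀ k, 0 ≤ qstar k) (hq1 : ∑ k, qstar k = 1)
    (z : Fin n → Ω → Fin T) (hmeas : ∀ i, Measurable (z i))
    (hindep : iIndepFun z μ)
    (hlaw : ∀ (i : Fin n) (k : Fin T), μ {ω | z i ω = k} = ENNReal.ofReal (qstar k))
    (M η t : ℝ) (hη : 0 < η) (ht : 0 < t)
    (hnet : ∃ S : Finset (Fin T → ℝ), (S.card : ℝ) ≤ M ∧
      ∀ α ∈ sparseBall T s B, ∃ β ∈ S, Real.sqrt (∑ k, (α k - β k) ^ 2) ≤ η)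
    (αstar : Fin T → ℝ)
    (hαstar : αstar ∈ {a ∈ sparseBall T s B |
      ∀ k, 0 < qstar k → c ≤ f (E.transpose.mulVec a) k})
    (hq_eq : qstar = f (E.transpose.mulVec αstar))
    (αhat : Ω → Fin T → ℝ)
    (hαhat_mem : ∀ ω, αhat ω ∈ {a ∈ sparseBall T s B |
      ∀ k, 0 < qstar k → c ≤ f (E.transpose.mulVec a) k})
    (hαhat_min : ∀ ω, ∀ α ∈ {a ∈ sparseBall T s B |
        ∀ k, 0 < qstar k → c ≤ f (E.transpose.mulVec a) k},
      (1 / n) * ∑ i, -Real.log (f (E.transpose.mulVec (αhat ω)) (z i ω))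
        ≤ (1 / n) * ∑ i, -Real.log (f (E.transpose.mulVec α) (z i ω))) :
    (μ {ω | 2 * t + 4 * (L * σ / c) * η
        ≤ KLdiv qstar (f (E.transpose.mulVec (αhat ω)))}).toReal
      ≤ 2 * M * Real.exp (-(2 * n * t ^ 2) / (Real.log c) ^ 2) := by
  classical
  obtain ⟨S, hSM, hS⟩ := hnet
  set A : Set (Fin T → ℝ) := {a ∈ sparseBall T s B |
      ∀ k, 0 < qstar k → c ≤ f (E.transpose.mulVec a) k} with hA
  have hlc : Real.log c < 0 := Real.log_neg hc0 hc1
  have hM1 : (1 : ℝ) ≤ S.card := by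
    obtain ⟨β, hβ, _⟩ := hS αstar hαstar.1
    exact_mod_cast Finset.card_pos.mpr ⟨β, hβ⟩
  rcases Nat.eq_zero_or_pos n with hn | hn
  · subst hn
    have : (μ {ω | 2 * t + 4 * (L * σ / c) * η
        ≤ KLdiv qstar (f (E.transpose.mulVec (αhat ω)))}).toReal ≤ 1 := measureReal_le_one
    refine this.trans ?_
    simp
    linarith
  have hnR : (0 : ℝ) < n := by exact_mod_cast hn
  have hσ0 : 0 ≤ σ := by
    have h := hσ (fun _ => 1)
    have hT : (0 : ℝ) < T := by
      have : 0 < T := by omega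
      exact_mod_cast this
    have h3 : 0 < Real.sqrt (∑ k : Fin T, ((fun _ => 1 : Fin T → ℝ) k) ^ 2) := by
      apply Real.sqrt_pos.mpr
      simpa using hT
    have h2 := (Real.sqrt_nonneg _).trans h
    exact nonneg_of_mul_nonneg_left h2 h3
  set δ := L * σ / c with hδ
  have hδ0 : 0 ≤ δ := by positivity
  let g : (Fin T → ℝ) → Fin T → ℝ := fun a k => Real.log (f (E.transpose.mulVec a) k)
  have hgIcc : ∀ a k, g a k ∈ Set.Icc (Real.log c) 0 := by
    intro a k
    rcases hrange (E.transpose.mulVec a) k with h | ⟨h1, h2⟩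
    · simp only [g, h, Real.log_zero]; exact ⟨hlc.le, le_rfl⟩
    · exact ⟨Real.log_le_log hc0 h1, Real.log_nonpos (by linarith) h2⟩
  have hglip : ∀ a ∈ A, ∀ b ∈ A, ∀ β : Fin T → ℝ, Real.sqrt (∑ k, (a k - β k) ^ 2) ≤ η →
      Real.sqrt (∑ k, (b k - β k) ^ 2) ≤ η → ∀ k, 0 < qstar k → g a k - g b k ≤ 2 * δ * η := by
    intro a ha b hb β h1 h2 k hk
    have h3 := aux_tri a b β h1 h2
    have h4 := aux_log hc0 (ha.2 k hk) (hb.2 k hk)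
    have h5 : |f (E.transpose.mulVec a) k - f (E.transpose.mulVec b) k| ≤ L * (σ * (2 * η)) := by
      calc _ ≤ ∑ k, |f (E.transpose.mulVec a) k - f (E.transpose.mulVec b) k| :=
            Finset.single_le_sum
              (f := fun k => |f (E.transpose.mulVec a) k - f (E.transpose.mulVec b) k|)
              (fun _ _ => abs_nonneg _) (Finset.mem_univ k)
        _ ≤ _ := hLip _ _
        _ ≤ L * (σ * Real.sqrt (∑ k, (a k - b k) ^ 2)) := by
            have := hσ (a - b)
            rw [Matrix.mulVec_sub] at this
            simp only [Pi.sub_apply] at this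
            gcongr
        _ ≤ _ := by gcongr
    calc _ ≤ _ := h4
      _ ≤ L * (σ * (2 * η)) / c := by gcongr
      _ = _ := by rw [hδ]; ring
  have hrep : ∀ β : Fin T → ℝ, ∃ r : Fin T → ℝ,
      (∃ a ∈ A, Real.sqrt (∑ k, (a k - β k) ^ 2) ≤ η) →
        r ∈ A ∧ Real.sqrt (∑ k, (r k - β k) ^ 2) ≤ η := by
    intro β
    by_cases h : ∃ a ∈ A, Real.sqrt (∑ k, (a k - β k) ^ 2) ≤ η
    · obtain ⟨a, h1, h2⟩ := h
      exact ⟨a, fun _ => ⟨h1, h2⟩⟩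
    · exact ⟨0, fun h' => absurd h' h⟩
  choose r hr using hrep
  let D0 : Set Ω := {ω | n * t ≤ ∑ i, ((fun k => -g αstar k) (z i ω)
    - ∑ k, qstar k * (fun k => -g αstar k) k)}
  let D : (Fin T → ℝ) → Set Ω := fun β => {ω | n * t ≤ ∑ i, (g (r β) (z i ω)
    - ∑ k, qstar k * g (r β) k)}
  set ε := Real.exp (-(2 * n * t ^ 2) / (Real.log c) ^ 2) with hε
  have hD0 : μ.real D0 ≤ ε := by
    have := aux_hoeff μ hn qstar hq0 z hmeas hindep hlaw (fun k => -g αstar k) 0 (-Real.log c)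
      (by linarith) (fun k => ⟨by linarith [(hgIcc αstar k).2], by linarith [(hgIcc αstar k).1]⟩)
      t ht
    refine this.trans (le_of_eq ?_)
    rw [hε]
    congr 2
    ring
  have hD : ∀ β, μ.real (D β) ≤ ε := by
    intro β
    have := aux_hoeff μ hn qstar hq0 z hmeas hindep hlaw (g (r β)) (Real.log c) 0
      hlc (hgIcc _) t ht
    refine this.trans (le_of_eq ?_)
    rw [hε]
    congr 2
    ring
  have hae : ∀ᵐ ω ∂μ, ∀ i, 0 < qstar (z i ω) := by
    rw [ae_all_iff]
    intro i
    have : ∀ᵐ ω ∂μ, ∀ k, qstar k = 0 → z i ω ≠ k := by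
      rw [ae_all_iff]
      intro k
      by_cases hk : qstar k = 0
      · have h0 : μ {ω | z i ω = k} = 0 := by rw [hlaw, hk]; simp
        filter_upwards [measure_eq_zero_iff_ae_notMem.mp h0] with ω hω _ using hω
      · exact Filter.Eventually.of_forall fun ω h => absurd h hk
    filter_upwards [this] with ω hω
    exact lt_of_le_of_ne (hq0 _) fun h => hω _ h.symm rfl
  have hsub : {ω | 2 * t + 4 * δ * η ≤ KLdiv qstar (f (E.transpose.mulVec (αhat ω)))}
      ≤ᵐ[μ] (D0 ∪ ⋃ β ∈ S, D β : Set Ω) := by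
    filter_upwards [hae] with ω hω hKL
    by_contra hcon
    have hcon' : ω ∉ (D0 ∪ ⋃ β ∈ S, D β : Set Ω) := hcon
    replace hKL : 2 * t + 4 * δ * η ≤ KLdiv qstar (f (E.transpose.mulVec (αhat ω))) := hKL
    simp only [Set.mem_union, Set.mem_iUnion, not_or, not_exists] at hcon'
    obtain ⟨hn0, hnD⟩ := hcon'
    obtain ⟨β, hβS, hβ⟩ := hS (αhat ω) (hαhat_mem ω).1
    obtain ⟨hrA, hrβ⟩ := hr β ⟨αhat ω, hαhat_mem ω, hβ⟩
    have hd := hnD β hβS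
    simp only [D0, D, Set.mem_setOf_eq, not_le, Finset.sum_sub_distrib, Finset.sum_const,
      Finset.card_univ, Fintype.card_fin, nsmul_eq_mul, mul_neg, Finset.sum_neg_distrib] at hn0 hd
    have hmin : ∑ i, g αstar (z i ω) ≤ ∑ i, g (αhat ω) (z i ω) := by
      have := hαhat_min ω αstar hαstar
      have := le_of_mul_le_mul_left this (by positivity)
      simp only [Finset.sum_neg_distrib] at this
      exact neg_le_neg_iff.mp this
    have hl1 : ∑ i, g (αhat ω) (z i ω) - ∑ i, g (r β) (z i ω) ≤ n * (2 * δ * η) := by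
      rw [← Finset.sum_sub_distrib]
      refine (Finset.sum_le_sum (g := fun _ => 2 * δ * η) fun i _ =>
        hglip _ (hαhat_mem ω) _ hrA β hβ hrβ _ (hω i)).trans ?_
      simp
    have hl2 : ∑ k, qstar k * g (r β) k - ∑ k, qstar k * g (αhat ω) k ≤ 2 * δ * η := by
      rw [← Finset.sum_sub_distrib]
      calc _ ≤ ∑ k, qstar k * (2 * δ * η) := by
            refine Finset.sum_le_sum fun k _ => ?_
            rw [← mul_sub]
            rcases (hq0 k).eq_or_lt with h | h
            · simp [← h]
            · exact mul_le_mul_of_nonneg_left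
                (hglip _ hrA _ (hαhat_mem ω) β hrβ hβ k h) h.le
        _ = _ := by rw [← Finset.sum_mul, hq1, one_mul]
    have hkl : KLdiv qstar (f (E.transpose.mulVec (αhat ω)))
        = ∑ k, qstar k * g αstar k - ∑ k, qstar k * g (αhat ω) k := by
      rw [← Finset.sum_sub_distrib, KLdiv, Finset.sum_filter]
      refine Finset.sum_congr rfl fun k _ => ?_
      split_ifs with h
      · have h2 : 0 < f (E.transpose.mulVec (αhat ω)) k := hc0.trans_le ((hαhat_mem ω).2 k h)
        rw [Real.log_div h.ne' h2.ne', mul_sub]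
        have h3 : qstar k = f (E.transpose.mulVec αstar) k := congrFun hq_eq k
        simp only [g]
        rw [← h3]
      · have : qstar k = 0 := le_antisymm (not_lt.mp h) (hq0 k)
        simp [this]
    rw [hkl] at hKL
    have h1 := mul_le_mul_of_nonneg_left hKL hnR.le
    have h2 := mul_le_mul_of_nonneg_left hl2 hnR.le
    linarith
  have hfin : μ.real {ω | 2 * t + 4 * δ * η ≤ KLdiv qstar (f (E.transpose.mulVec (αhat ω)))}
      ≤ μ.real (D0 ∪ ⋃ β ∈ S, D β : Set Ω) :=
    ENNReal.toReal_mono (measure_ne_top _ _) (measure_mono_ae hsub)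
  have hε0 : 0 < ε := Real.exp_pos _
  calc _ ≤ μ.real (D0 ∪ ⋃ β ∈ S, D β : Set Ω) := hfin
    _ ≤ μ.real D0 + μ.real (⋃ β ∈ S, D β) := measureReal_union_le _ _
    _ ≤ ε + ∑ β ∈ S, μ.real (D β) := add_le_add hD0 (measureReal_biUnion_finset_le _ _)
    _ ≤ ε + ∑ β ∈ S, ε := by gcongr with β _; exact hD β
    _ = (1 + S.card) * ε := by simp; ring
    _ ≤ 2 * M * ε := by gcongr; linarith
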